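/- The group SL_2(F_3), where F_3 is the field with 3 elements, is not the group of units of any finite unital ring. -/

import Mathlib

universe u

/-- The ring-theoretic core of the argument. -/
theorem core_contra {R : Type u} [Ring R] [Finite R] (I J K W Z : R)
    (hW : W * W * W = 1) (hIJ : W * I = J * W) (hJK : W * J = K * W) (hK : I * J = K)
    (hI : I * I = Z) (hZ : Z * Z = 1) (hZ1 : Z ≠ 1) (hZW : Z * W = W * Z)
    (hinv : ∀ u : R, u * u = 1 → u = 1 ∨ u = Z)
    (hcen : ∀ u v : R, u * v = 1 → v * u = 1 → (∀ x, u * x = x * u) → u = 1 ∨ u = Z)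
    (h4 : ∀ u v : R, u * v = 1 → v * u = 1 → (u * u) * (u * u) ≠ Z) : False := by
  -- The element `-1`.
  have hm : (-1 : R) = 1 ∨ (-1 : R) = Z := hinv _ (by simp)
  -- Either `6 = 0` or `2` is nilpotent.
  have h2 : (6 : R) = 0 ∨ IsNilpotent (2 : R) := by
    obtain ⟨N, hN, he⟩ : ∃ N : ℕ, 0 < N ∧ IsIdempotentElem ((2 : R) ^ N) := by
      obtain ⟨a, b, hab, h⟩ := Set.finite_univ.exists_lt_map_eq_of_forall_mem
        (f := fun n : ℕ => (2 : R) ^ n) (fun _ => Set.mem_univ _)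
      obtain ⟨p, rfl⟩ := Nat.exists_eq_add_of_lt hab
      have key : ∀ m, a ≤ m → (2 : R) ^ (m + (p + 1)) = 2 ^ m := by
        intro m hm
        obtain ⟨c, rfl⟩ := Nat.exists_eq_add_of_le hm
        rw [show a + c + (p + 1) = (a + p + 1) + c by ring, pow_add, ← h, ← pow_add]
      have key2 : ∀ t m, a ≤ m → (2 : R) ^ (m + t * (p + 1)) = 2 ^ m := by
        intro t
        induction t with
        | zero => intro m _; simp
        | succ t ih =>
          intro m hm
          rw [show m + (t + 1) * (p + 1) = (m + t * (p + 1)) + (p + 1) by ring,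
            key _ (by omega), ih m hm]
      refine ⟨(a + 1) * (p + 1), by positivity, ?_⟩
      unfold IsIdempotentElem
      rw [← pow_add]
      exact key2 _ _ (by nlinarith)
    obtain ⟨M, rfl⟩ : ∃ M, N = M + 1 := ⟨N - 1, by omega⟩
    generalize hq : (2 : R) ^ M = q at *
    have hqc : ∀ x, q * x = x * q := by
      intro x
      rw [← hq]
      exact ((Commute.ofNat_left 2 x).pow_left M)
    have hidem : (2 * q) * (2 * q) = 2 * q := by
      have := he
      unfold IsIdempotentElem at this
      rw [pow_succ', hq] at this
      exact this
    have h1 : (1 + 2 * q) * (q * (2 * q) + 1 - 2 * q) = 1 := by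
      have : (1 + 2 * q) * (q * (2 * q) + 1 - 2 * q)
        = 1 + q * ((2 * q) * (2 * q)) + q * (2 * q) - (2 * q) * (2 * q) := by noncomm_ring
      rw [this, hidem]
      have : 1 + q * (2 * q) + q * (2 * q) - 2 * q = 1 + ((2 * q) * (2 * q) - 2 * q) := by
        noncomm_ring
      rw [this, hidem]; simp
    have h1' : (q * (2 * q) + 1 - 2 * q) * (1 + 2 * q) = 1 := by
      refine Eq.trans ?_ h1; clear * -; grind
    have hc : (1 + 2 * q = 1) ∨ (1 + 2 * q = Z) := hcen _ _ h1 h1' (by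
      intro x
      have := hqc x
      have h3 : (1 + 2 * q) * x = x + 2 * (q * x) := by noncomm_ring
      rw [h3, this]; noncomm_ring)
    have hc' : (1 + 2 * q = 1) ∨ (1 + 2 * q = -1) ∨ (-1 : R) = 1 := by
      rcases hc with h | h
      · exact Or.inl h
      · rcases hm with h' | h'
        · exact Or.inr (Or.inr h')
        · exact Or.inr (Or.inl (h.trans h'.symm))
    rcases hc' with h | h | h
    · right
      refine ⟨M + 1, ?_⟩
      rw [pow_succ', hq]
      simpa using h
    · left
      have h5 : 2 * q = -2 := by
        have : 2 * q = (1 + 2 * q) - 1 := by noncomm_ring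
        rw [this, h]; norm_num
      rw [h5] at hidem
      have : (6 : R) = (-2) * (-2) - (-2) := by norm_num
      rw [this, hidem]; simp
    · left
      have : (6 : R) = 3 * (1 - (-1)) := by norm_num
      rw [this, h]; simp
  -- `4 = 0`.
  have hfour : (4 : R) = 0 := by
    rcases hm with h | h
    · have : (4 : R) = 2 * (1 - (-1)) := by norm_num
      rw [this, h]; simp
    · rcases h2 with h6 | hnil
      · exfalso
        have hII : I * I = -1 := by rw [hI, h]
        have e1 : (1 + 4 * I) * (1 + 4 * I) = 3 + 2 * I := by
          have : (1 + 4 * I) * (1 + 4 * I) = 1 + 8 * I + 16 * (I * I) := by grind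
          rw [this, hII]
          have : (1 + 8 * I + 16 * (-1) : R) = 3 + 2 * I + 6 * (I - 3) := by grind
          rw [this, h6]; simp
        have e2 : (3 + 2 * I) * (3 + 2 * I) = -1 := by
          have : (3 + 2 * I) * (3 + 2 * I) = 9 + 12 * I + 4 * (I * I) := by grind
          rw [this, hII]
          have : (9 + 12 * I + 4 * (-1) : R) = -1 + 6 * (2 * I + 1) := by grind
          rw [this, h6]; simp
        have e3 : (1 + 4 * I) * (-((1 + 4 * I) * (3 + 2 * I))) = 1 := by
          rw [mul_neg, ← mul_assoc, e1, e2]; simp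
        have e4 : (-((1 + 4 * I) * (3 + 2 * I))) * (1 + 4 * I) = 1 := by
          refine Eq.trans ?_ e3; clear * -; grind
        exact h4 _ _ e3 e4 (by rw [e1, e2, h])
      · have hu : IsUnit (1 + 2 : R) := hnil.isUnit_one_add
        obtain ⟨⟨u, v, huv, hvu⟩, hu⟩ := hu
        simp only at hu
        subst hu
        rcases hcen _ v huv hvu (by intro x; noncomm_ring) with h' | h'
        · have : (4 : R) = 2 * ((1 + 2) - 1) := by norm_num
          rw [this, h']; simp
        · rw [← h] at h'
          have : (4 : R) = (1 + 2) - (-1) := by norm_num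
          rw [this, h']; simp
  -- `2 d = 0` for `d = 1 - Z`.
  have h2d : 2 * (1 - Z) = 0 := by
    rcases hm with h | h
    · have : (2 : R) = 1 - (-1) := by norm_num
      rw [this, h]; simp
    · rw [← h]
      have : (2 : R) * (1 - (-1)) = 4 := by norm_num
      rw [this, hfour]
  obtain ⟨d, hd⟩ : ∃ d, d = 1 - Z := ⟨_, rfl⟩
  have hZd : Z = 1 - d := by rw [hd]; noncomm_ring
  rw [← hd] at h2d
  have hd0 : d ≠ 0 := by
    intro h; apply hZ1; rw [hZd, h]; simp
  have hdd : d * d = 0 := by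
    have : d * d = 2 * d - 1 + Z * Z := by rw [hZd]; noncomm_ring
    rw [this, h2d, hZ]; simp
  have hdW : d * W = W * d := by
    rw [hd, sub_mul, mul_sub, hZW]; simp
  have hdWd : d * W = d := by
    have e1 : (1 - d * W) * (1 - d * W) = 1 := by
      have : (1 - d * W) * (1 - d * W) = 1 - (2 * d) * W + d * (W * d) * W := by noncomm_ring
      rw [this, h2d, ← hdW, ← mul_assoc, hdd]; simp
    rcases hinv _ e1 with h | h
    · exfalso
      have h0 : d * W = 0 := by
        have : d * W = 1 - (1 - d * W) := by noncomm_ring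
        rw [this, h]; simp
      apply hd0
      calc d = d * (W * W * W) := by rw [hW, mul_one]
        _ = (d * W) * W * W := by noncomm_ring
        _ = 0 := by rw [h0]; simp
    · have : d * W = 1 - (1 - d * W) := by noncomm_ring
      rw [this, h, hd]
  have h2W : 2 * W = 2 := by
    rcases hm with h | h
    · have : (2 : R) = 1 - (-1) := by norm_num
      rw [this, h]; simp
    · have : (2 : R) = d := by rw [hd, ← h]; norm_num
      rw [this, hdWd]
  obtain ⟨e, he⟩ : ∃ e, e = -(1 + W + W * W) := ⟨_, rfl⟩
  have h2e : 2 * e = 2 := by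
    have : 2 * e = -(2 + 2 * W + (2 * W) * W) := by rw [he]; clear * -; grind
    rw [this, h2W, h2W]
    have : (-(2 + 2 + 2) : R) = 2 - 4 * 2 := by norm_num
    rw [this, hfour]; simp
  have heW : e * W = e := by
    have : e * W = -(W + W * W + W * W * W) := by rw [he]; noncomm_ring
    rw [this, hW, he]; abel
  have hee : e * e = e := by
    have : e * e = -(e + e * W + e * W * W) := by
      nth_rewrite 2 [he]; noncomm_ring
    rw [this, heW, heW]
    have : -(e + e + e) = e - 4 * e := by noncomm_ring
    rw [this, hfour]; simp
  have hde : d * e = d := by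
    have : d * e = -(d + d * W + d * W * W) := by rw [he]; noncomm_ring
    rw [this, hdWd, hdWd]
    have : -(d + d + d) = d - 2 * (2 * d) := by noncomm_ring
    rw [this, h2d]; simp
  have hed : e * d = d := by
    have : e * d = -(d + W * d + W * (W * d)) := by rw [he]; noncomm_ring
    rw [this, ← hdW, hdWd, ← hdW, hdWd]
    have : -(d + d + d) = d - 2 * (2 * d) := by noncomm_ring
    rw [this, h2d]; simp
  have hsq : ∀ y : R, y * y = 0 → 2 * y = 0 → y = 0 ∨ y = -d := by
    intro y h1 h2
    have : (1 + y) * (1 + y) = 1 := by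
      have : (1 + y) * (1 + y) = 1 + 2 * y + y * y := by noncomm_ring
      rw [this, h1, h2]; simp
    rcases hinv _ this with h | h
    · left; simpa using h
    · right
      have : y = (1 + y) - 1 := by noncomm_ring
      rw [this, h, hZd]; noncomm_ring
  have hfe : (1 - e) * e = 0 := by rw [sub_mul, hee]; simp
  have hef : e * (1 - e) = 0 := by rw [mul_sub, hee]; simp
  have h2f : 2 * (1 - e) = 0 := by rw [mul_sub, h2e]; simp
  have c1 : ∀ x, e * x * (1 - e) = 0 := by
    intro x
    rcases hsq (e * x * (1 - e)) (by
        have : e * x * (1 - e) * (e * x * (1 - e)) = e * x * ((1 - e) * e) * x * (1 - e) := by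
          noncomm_ring
        rw [this, hfe]; simp) (by
        have : 2 * (e * x * (1 - e)) = e * x * (2 * (1 - e)) := by noncomm_ring
        rw [this, h2f]; simp) with h | h
    · exact h
    · exfalso
      apply hd0
      have h5 : e * x * (1 - e) * e = 0 := by rw [mul_assoc, hfe]; simp
      rw [h, neg_mul, hde] at h5
      simpa using h5
  have c2 : ∀ x, (1 - e) * x * e = 0 := by
    intro x
    rcases hsq ((1 - e) * x * e) (by
        have : (1 - e) * x * e * ((1 - e) * x * e) = (1 - e) * x * (e * (1 - e)) * x * e := by
          noncomm_ring
        rw [this, hef]; simp) (by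
        have : 2 * ((1 - e) * x * e) = (2 * (1 - e)) * x * e := by noncomm_ring
        rw [this, h2f]; simp) with h | h
    · exact h
    · exfalso
      apply hd0
      have h5 : e * ((1 - e) * x * e) = 0 := by
        rw [← mul_assoc, ← mul_assoc, hef]; simp
      rw [h, mul_neg, hed] at h5
      simpa using h5
  have hc : ∀ x, e * x = x * e := by
    intro x
    have h1 : e * x = e * x * e := by
      have := c1 x
      rw [mul_sub, mul_one, sub_eq_zero] at this
      exact this
    have h2 : x * e = e * x * e := by
      have := c2 x
      rw [sub_mul, one_mul, sub_mul, sub_eq_zero] at this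
      exact this
    rw [h1, h2]
  -- modulo `1 - e`, `W` becomes `1`
  have hWe : W * e = e := by rw [← hc, heW]
  have t1 : ∀ a b : R, W * a = b * W → e * a = e * b := by
    intro a b h
    calc e * a = e * W * a := by rw [heW]
      _ = e * (W * a) := by noncomm_ring
      _ = (e * b) * W := by rw [h]; noncomm_ring
      _ = b * (e * W) := by rw [hc b]; noncomm_ring
      _ = e * b := by rw [heW, hc]
  have hij := t1 _ _ hIJ
  have hjk := t1 _ _ hJK
  have hz : e * Z = e * I := by
    calc e * Z = (e * I) * I := by rw [← hI]; noncomm_ring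
      _ = I * (e * I) := by rw [hc I, mul_assoc, hc I]
      _ = (I * e) * J := by rw [hij]; noncomm_ring
      _ = e * (I * J) := by rw [← hc I]; noncomm_ring
      _ = e * I := by rw [hK, hij, hjk]
  have hz1 : e * Z = e := by
    have h1 : (e * Z) * Z = e := by rw [mul_assoc, hZ, mul_one]
    have h2 : (e * I) * I = e * Z := by rw [mul_assoc, hI]
    have h3 : e * I * Z = e * Z * I := by rw [← hI]; noncomm_ring
    calc e * Z = e * I * I := h2.symm
      _ = e * Z * I := by rw [← hz]
      _ = e * I * Z := h3.symm
      _ = e * Z * Z := by rw [hz]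
      _ = e := h1
  apply hd0
  rw [← hed, hd, mul_sub, hz1]; simp

/-- Shorthand for the group. -/
abbrev G3 := Matrix.SpecialLinearGroup (Fin 2) (ZMod 3)

/-- Computable finiteness of the group. -/
abbrev fintypeG3 : Fintype G3 :=
  inferInstanceAs (Fintype {A : Matrix (Fin 2) (Fin 2) (ZMod 3) // A.det = 1})

/-- Computable equality on the group. -/
abbrev decEqG3 : DecidableEq G3 :=
  inferInstanceAs (DecidableEq {A : Matrix (Fin 2) (Fin 2) (ZMod 3) // A.det = 1})

attribute [local instance] fintypeG3 decEqG3

/-- An element of order 4. -/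
def gI : G3 := ⟨!![0, 2; 1, 0], by decide⟩
/-- An element of order 3. -/
def gW : G3 := ⟨!![1, 1; 0, 1], by decide⟩
/-- The central involution. -/
def gZ : G3 := ⟨!![2, 0; 0, 2], by decide⟩

theorem g3_inv : ∀ g : G3, g * g = 1 → g = 1 ∨ g = gZ := by decide +kernel
theorem g3_cen : ∀ g : G3, g * gI = gI * g → g * gW = gW * g → g = 1 ∨ g = gZ := by
  decide +kernel
theorem g3_four : ∀ g : G3, (g * g) * (g * g) ≠ gZ := by decide +kernel
theorem g3_k : gI * (gW * gI * gW⁻¹) = gW * (gW * gI * gW⁻¹) * gW⁻¹ := by decide +kernel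
theorem g3_w : gW * gW * gW = 1 := by decide +kernel
theorem g3_i : gI * gI = gZ := by decide +kernel
theorem g3_z : gZ * gZ = 1 := by decide +kernel
theorem g3_z1 : gZ ≠ 1 := by decide +kernel
theorem g3_zw : gZ * gW = gW * gZ := by decide +kernel

/-- The group `SL₂(F₃)` (the binary tetrahedral group) is not the group of units
of any finite unital ring. -/
theorem sl2_zmod3_not_realizable_finite :
    ∀ (R : Type u) [Ring R] [Finite R],
      ¬ Nonempty (Rˣ ≃* Matrix.SpecialLinearGroup (Fin 2) (ZMod 3)) := by
  intro R _ _ ⟨φ⟩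
  have ginv := g3_inv
  have gcen := g3_cen
  have g4 := g3_four
  have gk := g3_k
  have gw := g3_w
  have gi := g3_i
  have gz := g3_z
  have gz1 := g3_z1
  have gzw := g3_zw
  generalize gZ = z at *
  generalize gI = i at *
  generalize gW = w at *
  obtain ⟨j, hj⟩ : ∃ j, j = w * i * w⁻¹ := ⟨_, rfl⟩
  rw [← hj] at gk
  obtain ⟨k, hk⟩ : ∃ k, k = w * j * w⁻¹ := ⟨_, rfl⟩
  rw [← hk] at gk
  have gij : w * i = j * w := by simp [hj]
  have gjk : w * j = k * w := by simp [hk]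
  have tr : ∀ a b c d : Matrix.SpecialLinearGroup (Fin 2) (ZMod 3), a * b = c * d →
      ((φ.symm a : Rˣ) : R) * (φ.symm b : Rˣ) = (φ.symm c : Rˣ) * (φ.symm d : Rˣ) := by
    intro a b c d h
    rw [← Units.val_mul, ← Units.val_mul, ← map_mul, ← map_mul, h]
  have tr1 : ∀ a b c : Matrix.SpecialLinearGroup (Fin 2) (ZMod 3), a * b = c →
      ((φ.symm a : Rˣ) : R) * (φ.symm b : Rˣ) = (φ.symm c : Rˣ) := by
    intro a b c h
    rw [← Units.val_mul, ← map_mul, h]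
  have lift : ∀ u : Rˣ, φ u = 1 ∨ φ u = z → (u : R) = 1 ∨ (u : R) = (φ.symm z : Rˣ) := by
    rintro u (h | h)
    · left
      rw [map_eq_one_iff φ φ.injective] at h
      simp [h]
    · right
      rw [← h]; simp
  refine core_contra (R := R) (φ.symm i : Rˣ) (φ.symm j : Rˣ) (φ.symm k : Rˣ) (φ.symm w : Rˣ)
    (φ.symm z : Rˣ) ?_ (tr _ _ _ _ gij) (tr _ _ _ _ gjk) (tr1 _ _ _ gk) (tr1 _ _ _ gi) ?_ ?_
    (tr _ _ _ _ gzw) ?_ ?_ ?_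
  · rw [tr1 _ _ _ rfl, tr1 _ _ _ gw]; simp
  · rw [tr1 _ _ _ gz]; simp
  · intro h
    apply gz1
    have : φ.symm z = 1 := Units.ext h
    simpa using this
  · intro u hu
    refine lift ⟨u, u, hu, hu⟩ (ginv _ ?_)
    rw [← map_mul, map_eq_one_iff φ φ.injective]
    exact Units.ext hu
  · intro u v huv hvu hc
    have key : ∀ g, φ ⟨u, v, huv, hvu⟩ * g = g * φ ⟨u, v, huv, hvu⟩ := by
      intro g
      obtain ⟨x, rfl⟩ := φ.surjective g
      rw [← map_mul, ← map_mul]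
      congr 1
      exact Units.ext (hc x)
    exact lift ⟨u, v, huv, hvu⟩ (gcen _ (key i) (key w))
  · intro u v huv hvu h
    apply g4 (φ ⟨u, v, huv, hvu⟩)
    rw [← map_mul, ← map_mul, ← φ.apply_symm_apply z]
    congr 1
    exact Units.ext h
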